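/- arXiv:math/0701539 — 3 statements merged into one kernel-verified Lean document; each statement's English description precedes it below -/
import Mathlib

section
/- Let u' and u'' be packed words. Then, as an identity of polynomials in ℚ[t], ∑_γ binom(t, max(γ)) = binom(t, max(u')) · binom(t, max(u'')), where the sum is over all packed words γ of length |u'| + |u''| such that γ = v·w with |v| = |u'|, pack(v) = u' and pack(w) = u''. (This expresses that M_u ↦ binom(t, max(u)) is an algebra homomorphism from WQSym to ℚ[t].) -/
open Polynomial

/-- The packed word of `w`: each occurrence of the `i`-th smallest letter occurring in `w`
is replaced by `i` (so the letter `a` becomes the number of distinct letters of `w`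
that are `≤ a`). -/
def pack (w : List ℕ) : List ℕ :=
  w.map fun a => w.dedup.countP fun x => x ≤ a

/-- The maximal letter of a word (`0` for the empty word). -/
def maxL (w : List ℕ) : ℕ := w.foldr max 0

/-- A finset containing all lists of length `n` with entries `≤ n`; in particular it
contains all packed words of length `n`. -/
def allLists (n : ℕ) : Finset (List ℕ) :=
  Finset.image (fun f : Fin n → Fin (n + 1) => List.ofFn fun i => (f i : ℕ)) Finset.univ

/-- The generalized binomial coefficient `binom(t, k) = t(t-1)⋯(t-k+1)/k!`
as a polynomial in `t`. -/
noncomputable def binomPoly (k : ℕ) : Polynomial ℚ :=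
  ((Nat.factorial k : ℚ))⁻¹ • descPochhammer ℚ k

/-- The number of elements of `S` that are at most `x`. -/
def rankIn (S : Finset ℕ) (x : ℕ) : ℕ := (S.filter (· ≤ x)).card

/-- The words of length `m` over the letters `0, …, n - 1`. -/
def wordsLT (n m : ℕ) : Finset (List ℕ) :=
  Finset.image (fun f : Fin m → Fin n => List.ofFn fun i => (f i : ℕ)) Finset.univ

/-- The words over the letters `0, …, n - 1` whose packed word is `u`. -/
def unpackings (n : ℕ) (u : List ℕ) : Finset (List ℕ) :=
  (wordsLT n u.length).filter fun w => pack w = u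

theorem mem_wordsLT {n m : ℕ} {w : List ℕ} :
    w ∈ wordsLT n m ↔ w.length = m ∧ ∀ x ∈ w, x < n := by
  constructor
  · intro h
    obtain ⟨f, -, rfl⟩ := Finset.mem_image.1 h
    refine ⟨by simp, fun x hx => ?_⟩
    obtain ⟨i, rfl⟩ := (List.mem_ofFn' _ _).1 hx
    exact (f i).2
  · rintro ⟨rfl, h⟩
    exact Finset.mem_image.2
      ⟨fun i => ⟨w.get i, h _ (List.get_mem w i)⟩, Finset.mem_univ _, by simp⟩

theorem pack_eq_map_rankIn (w : List ℕ) : pack w = w.map (rankIn w.toFinset) := by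
  unfold pack
  refine List.map_congr_left fun a _ => ?_
  have h : (w.toFinset.filter (· ≤ a)) = (w.dedup.filter fun x => x ≤ a).toFinset := by
    ext x; simp
  rw [rankIn, h, List.toFinset_card_of_nodup (w.nodup_dedup.filter _), List.countP_eq_length_filter]

theorem length_pack (w : List ℕ) : (pack w).length = w.length := by simp [pack]

theorem rankIn_strictMonoOn (S : Finset ℕ) : StrictMonoOn (rankIn S) S := by
  intro x _ y hy hxy
  refine Finset.card_lt_card (Finset.ssubset_iff_subset_ne.2 ⟨fun z hz => ?_, fun h => ?_⟩)
  · simp only [Finset.mem_filter] at hz ⊢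
    exact ⟨hz.1, by omega⟩
  · have hy' : y ∈ S.filter (· ≤ x) := h ▸ Finset.mem_filter.2 ⟨hy, le_rfl⟩
    have := (Finset.mem_filter.1 hy').2
    omega

theorem rankIn_image {S T : Finset ℕ} {f : ℕ → ℕ} (hf : StrictMonoOn f S) (hT : T = S.image f)
    {x : ℕ} (hx : x ∈ S) : rankIn T (f x) = rankIn S x := by
  subst hT
  have h : (S.image f).filter (· ≤ f x) = (S.filter (· ≤ x)).image f := by
    ext y
    simp only [Finset.mem_filter, Finset.mem_image]
    constructor
    · rintro ⟨⟨z, hz, rfl⟩, hle⟩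
      exact ⟨z, ⟨hz, (hf.le_iff_le hz hx).1 hle⟩, rfl⟩
    · rintro ⟨z, ⟨hz, hle⟩, rfl⟩
      exact ⟨⟨z, hz, rfl⟩, (hf.le_iff_le hz hx).2 hle⟩
  rw [rankIn, h, Finset.card_image_of_injOn, rankIn]
  exact hf.injOn.mono fun z hz => (Finset.mem_filter.1 hz).1

theorem toFinset_map (f : ℕ → ℕ) (w : List ℕ) : (w.map f).toFinset = w.toFinset.image f := by
  ext x; simp

theorem pack_map {f : ℕ → ℕ} {w : List ℕ} (hf : StrictMonoOn f w.toFinset) :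
    pack (w.map f) = pack w := by
  rw [pack_eq_map_rankIn, pack_eq_map_rankIn, List.map_map]
  exact List.map_congr_left fun x hx =>
    rankIn_image hf (toFinset_map f w) (List.mem_toFinset.2 hx)

theorem pack_pack (w : List ℕ) : pack (pack w) = pack w := by
  conv_lhs => rw [pack_eq_map_rankIn w]
  exact pack_map (rankIn_strictMonoOn _)

theorem pack_take_pack (w : List ℕ) (k : ℕ) : pack ((pack w).take k) = pack (w.take k) := by
  rw [pack_eq_map_rankIn w, ← List.map_take]
  refine pack_map ((rankIn_strictMonoOn _).mono fun x hx => ?_)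
  exact List.mem_toFinset.2 (List.mem_of_mem_take (List.mem_toFinset.1 hx))

theorem pack_drop_pack (w : List ℕ) (k : ℕ) : pack ((pack w).drop k) = pack (w.drop k) := by
  rw [pack_eq_map_rankIn w, ← List.map_drop]
  refine pack_map ((rankIn_strictMonoOn _).mono fun x hx => ?_)
  exact List.mem_toFinset.2 (List.mem_of_mem_drop (List.mem_toFinset.1 hx))

theorem mem_pack_bounds {w : List ℕ} {x : ℕ} (hx : x ∈ pack w) :
    1 ≤ x ∧ x ≤ w.toFinset.card := by
  rw [pack_eq_map_rankIn] at hx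
  obtain ⟨y, hy, rfl⟩ := List.mem_map.1 hx
  exact ⟨Finset.card_pos.2 ⟨y, Finset.mem_filter.2 ⟨List.mem_toFinset.2 hy, le_rfl⟩⟩,
    Finset.card_le_card (Finset.filter_subset _ _)⟩

theorem le_maxL {w : List ℕ} {x : ℕ} (hx : x ∈ w) : x ≤ maxL w := by
  induction w with
  | nil => simp at hx
  | cons a w ih =>
    rcases List.mem_cons.1 hx with rfl | h
    · exact le_max_left _ _
    · exact (ih h).trans (le_max_right _ _)

theorem maxL_le {w : List ℕ} {k : ℕ} (h : ∀ x ∈ w, x ≤ k) : maxL w ≤ k := by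
  induction w with
  | nil => exact Nat.zero_le _
  | cons a w ih =>
    exact max_le (h a (by simp)) (ih fun x hx => h x (by simp [hx]))

theorem maxL_pack (w : List ℕ) : maxL (pack w) = w.toFinset.card := by
  refine le_antisymm (maxL_le fun x hx => (mem_pack_bounds hx).2) ?_
  rcases w.toFinset.eq_empty_or_nonempty with h | h
  · simp [h]
  · refine le_maxL ?_
    rw [pack_eq_map_rankIn]
    refine List.mem_map.2 ⟨w.toFinset.max' h, List.mem_toFinset.1 (Finset.max'_mem _ h), ?_⟩
    rw [rankIn, Finset.filter_true_of_mem fun x hx => Finset.le_max' _ x hx]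

theorem exists_pack_eq_toFinset_eq {u : List ℕ} (hu : pack u = u) {S : Finset ℕ}
    (hS : S.card = maxL u) :
    ∃ w : List ℕ, pack w = u ∧ w.toFinset = S := by
  have hcard : u.toFinset.card = S.card := by rw [hS, ← maxL_pack u, hu]
  have hfin : ∀ hf : {i | i ∈ S}.Finite, hf.toFinset = S := fun hf => by ext; simp
  have hbound : ∀ x ∈ u.toFinset, 1 ≤ x ∧ x ≤ S.card := fun x hx => by
    rw [← hcard]
    exact mem_pack_bounds (by rw [hu]; exact List.mem_toFinset.1 hx)
  have hmono : StrictMonoOn (fun i => Nat.nth (· ∈ S) (i - 1)) u.toFinset := by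
    intro x hx y hy hxy
    have h₁ := hbound x hx
    have h₂ := hbound y hy
    refine Nat.nth_lt_nth' (by omega) fun hf => ?_
    rw [hfin hf]
    omega
  refine ⟨u.map fun i => Nat.nth (· ∈ S) (i - 1), (pack_map hmono).trans hu, ?_⟩
  rw [toFinset_map]
  refine Finset.eq_of_subset_of_card_le (fun y hy => ?_) ?_
  · obtain ⟨x, hx, rfl⟩ := Finset.mem_image.1 hy
    have := hbound x hx
    exact Nat.nth_mem (p := (· ∈ S)) (x - 1) fun hf => by
      rw [hfin hf]
      omega
  · rw [Finset.card_image_of_injOn hmono.injOn, hcard]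

theorem eq_of_pack_eq_of_toFinset_eq {v w : List ℕ} (hp : pack v = pack w)
    (hs : v.toFinset = w.toFinset) : v = w := by
  rw [pack_eq_map_rankIn, pack_eq_map_rankIn, hs] at hp
  have hinj := (rankIn_strictMonoOn w.toFinset).injOn
  refine List.ext_getElem (by simpa using congrArg List.length hp) fun i h₁ h₂ => ?_
  refine hinj ?_ ?_ ?_
  · rw [← hs]; simp
  · simp
  · have := List.getElem_of_eq hp (i := i) (by simpa using h₁)
    simpa using this

theorem card_unpackings (n : ℕ) {u : List ℕ} (hu : pack u = u) :
    (unpackings n u).card = n.choose (maxL u) := by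
  rw [← Finset.card_range n, ← Finset.card_powersetCard, Finset.card_range]
  refine Finset.card_nbij List.toFinset ?_ ?_ ?_
  · intro w hw
    obtain ⟨hw, hp⟩ := Finset.mem_filter.1 hw
    refine Finset.mem_powersetCard.2 ⟨fun x hx => ?_, ?_⟩
    · exact Finset.mem_range.2 ((mem_wordsLT.1 hw).2 x (List.mem_toFinset.1 hx))
    · rw [← hp, maxL_pack]
  · intro v hv w hw h
    exact eq_of_pack_eq_of_toFinset_eq
      ((Finset.mem_filter.1 hv).2.trans (Finset.mem_filter.1 hw).2.symm) h
  · intro S hS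
    obtain ⟨hS, hc⟩ := Finset.mem_powersetCard.1 hS
    obtain ⟨w, hp, rfl⟩ := exists_pack_eq_toFinset_eq hu hc
    refine ⟨w, Finset.mem_filter.2 ⟨mem_wordsLT.2 ⟨?_, fun x hx => ?_⟩, hp⟩, rfl⟩
    · rw [← hp, length_pack]
    · exact Finset.mem_range.1 (hS (List.mem_toFinset.2 hx))

theorem eval_binomPoly (k n : ℕ) : (binomPoly k).eval (n : ℚ) = n.choose k := by
  rw [binomPoly, eval_smul, descPochhammer_eval_eq_descFactorial,
    Nat.descFactorial_eq_factorial_mul_choose, smul_eq_mul, Nat.cast_mul, ← mul_assoc,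
    inv_mul_cancel₀ (Nat.cast_ne_zero.2 k.factorial_ne_zero), one_mul]

theorem card_filter_pack_take_drop (n : ℕ) (a b : List ℕ) :
    ((wordsLT n (a.length + b.length)).filter
      (fun w => pack (w.take a.length) = a ∧ pack (w.drop a.length) = b)).card
      = (unpackings n a).card * (unpackings n b).card := by
  rw [← Finset.card_product]
  refine Finset.card_nbij' (fun w => (w.take a.length, w.drop a.length))
    (fun p => p.1 ++ p.2) ?_ ?_ ?_ ?_
  · intro w hw
    obtain ⟨hw, h₁, h₂⟩ := Finset.mem_filter.1 hw
    obtain ⟨hl, hn⟩ := mem_wordsLT.1 hw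
    refine Finset.mem_product.2 ⟨Finset.mem_filter.2 ⟨mem_wordsLT.2 ⟨?_, ?_⟩, h₁⟩,
      Finset.mem_filter.2 ⟨mem_wordsLT.2 ⟨?_, ?_⟩, h₂⟩⟩
    · simp [hl]
    · exact fun x hx => hn x (List.mem_of_mem_take hx)
    · simp [hl]
    · exact fun x hx => hn x (List.mem_of_mem_drop hx)
  · rintro ⟨v, w⟩ hp
    obtain ⟨hv, hw⟩ := Finset.mem_product.1 hp
    obtain ⟨hv, hpv⟩ := Finset.mem_filter.1 hv
    obtain ⟨hw, hpw⟩ := Finset.mem_filter.1 hw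
    obtain ⟨hlv, hnv⟩ := mem_wordsLT.1 hv
    obtain ⟨hlw, hnw⟩ := mem_wordsLT.1 hw
    refine Finset.mem_filter.2 ⟨mem_wordsLT.2 ⟨?_, fun x hx => ?_⟩, ?_, ?_⟩
    · rw [List.length_append, hlv, hlw]
    · exact (List.mem_append.1 hx).elim (hnv x) (hnw x)
    · rw [List.take_left' hlv]; exact hpv
    · rw [List.drop_left' hlv]; exact hpw
  · intro w _
    exact List.take_append_drop _ _
  · rintro ⟨v, w⟩ hp
    have hlv := (mem_wordsLT.1 (Finset.mem_filter.1 (Finset.mem_product.1 hp).1).1).1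
    exact Prod.ext (List.take_left' hlv) (List.drop_left' hlv)

theorem pack_mem_allLists (w : List ℕ) : pack w ∈ allLists w.length :=
  mem_wordsLT.2 ⟨length_pack w, fun _ hx =>
    Nat.lt_succ_of_le ((mem_pack_bounds hx).2.trans (List.toFinset_card_le w))⟩

theorem card_filter_pack_take_drop_eq_sum (n : ℕ) (a b : List ℕ) :
    ((wordsLT n (a.length + b.length)).filter
      (fun w => pack (w.take a.length) = a ∧ pack (w.drop a.length) = b)).card
      = ∑ γ ∈ (allLists (a.length + b.length)).filter
        (fun w => pack w = w ∧ pack (w.take a.length) = a ∧ pack (w.drop a.length) = b),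
        (unpackings n γ).card := by
  rw [Finset.card_eq_sum_card_fiberwise (f := pack)]
  · refine Finset.sum_congr rfl fun γ hγ => congrArg Finset.card ?_
    obtain ⟨hγ, -, h₁, h₂⟩ := Finset.mem_filter.1 hγ
    have hl : γ.length = a.length + b.length := (mem_wordsLT.1 hγ).1
    ext w
    rw [unpackings, hl, Finset.mem_filter, Finset.mem_filter, Finset.mem_filter]
    refine ⟨fun h => ⟨h.1.1, h.2⟩, fun h => ⟨⟨h.1, ?_, ?_⟩, h.2⟩⟩
    · rw [← pack_take_pack, h.2, h₁]
    · rw [← pack_drop_pack, h.2, h₂]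
  · intro w hw
    obtain ⟨hw, h₁, h₂⟩ := Finset.mem_filter.1 hw
    refine Finset.mem_filter.2 ⟨?_, pack_pack w, ?_, ?_⟩
    · exact (mem_wordsLT.1 hw).1 ▸ pack_mem_allLists w
    · rw [pack_take_pack, h₁]
    · rw [pack_drop_pack, h₂]

/-- **`M_u ↦ binom(t, max u)` is an algebra homomorphism `WQSym → ℚ[t]`**: for packed
words `u'`, `u''`, the sum of `binom(t, max γ)` over the packed words `γ` of length
`|u'| + |u''|` of the form `γ = v·w` with `|v| = |u'|`, `pack v = u'` and `pack w = u''`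
equals `binom(t, max u') · binom(t, max u'')` in `ℚ[t]`. -/
theorem wqsym_hom (a b : List ℕ) (ha : pack a = a) (hb : pack b = b) :
    ∑ w ∈ (allLists (a.length + b.length)).filter
        (fun w => pack w = w ∧ pack (w.take a.length) = a ∧ pack (w.drop a.length) = b),
      binomPoly (maxL w)
      = binomPoly (maxL a) * binomPoly (maxL b) := by
  refine Polynomial.eq_of_infinite_eval_eq _ _
    ((Set.infinite_range_of_injective (Nat.cast_injective (R := ℚ))).mono ?_)
  rintro _ ⟨n, rfl⟩
  rw [Set.mem_ofPred_eq, eval_finsetSum, eval_mul, eval_binomPoly, eval_binomPoly,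
    ← card_unpackings n ha, ← card_unpackings n hb, ← Nat.cast_mul,
    ← card_filter_pack_take_drop, card_filter_pack_take_drop_eq_sum, Nat.cast_sum]
  refine Finset.sum_congr rfl fun γ hγ => ?_
  rw [eval_binomPoly, card_unpackings n (Finset.mem_filter.1 hγ).2.1]
end

section
/- For every n ≥ 1, (n+1)^{n−1} = (n!/2ⁿ) · ∑_{T ∈ BT_n} ∏_{v ∈ T} (1 + 1/h_v), where BT_n is the set of binary trees with n nodes, the product is over all nodes v of T, and h_v is the hook length of v (Postnikov's identity). -/
/-- Incomplete binary trees: either empty, or a root node with a left and a right subtree. -/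
inductive BT : Type
  | nil : BT
  | node : BT → BT → BT
  deriving DecidableEq

namespace BT

/-- Number of nodes of a binary tree. -/
def size : BT → ℕ
  | nil => 0
  | node l r => size l + size r + 1

end BT

/-- The product `∏_{v ∈ T} (1 + 1/h_v)` over all nodes `v` of the binary tree `T`,
where `h_v` is the hook length of `v` (number of nodes of the subtree rooted at `v`). -/
def hookFacProd : BT → ℚ
  | BT.nil => 1
  | BT.node l r => (1 + ((l.size + r.size + 1 : ℕ) : ℚ)⁻¹) * hookFacProd l * hookFacProd r

section

open Finset Polynomial

namespace BT

theorem finite_setOf_size_eq (n : ℕ) : {T : BT | T.size = n}.Finite := by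
  induction n using Nat.strong_induction_on with
  | _ n ih =>
    have hfin : (insert nil (⋃ i : Fin n, ⋃ j : Fin n,
        Set.image2 node {T | T.size = i} {T | T.size = j})).Finite :=
      Set.Finite.insert _ (Set.finite_iUnion fun i => Set.finite_iUnion fun j =>
        (ih i i.2).image2 _ (ih j j.2))
    refine hfin.subset ?_
    rintro (_ | ⟨l, r⟩) h
    · exact Set.mem_insert _ _
    · simp only [Set.mem_ofPred_eq, size] at h
      refine Set.mem_insert_of_mem _ (Set.mem_iUnion₂.2
        ⟨⟨l.size, by omega⟩, ⟨r.size, by omega⟩, l, rfl, r, rfl, rfl⟩)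

/-- The finset of binary trees with `n` nodes. -/
noncomputable def ofSize (n : ℕ) : Finset BT := (finite_setOf_size_eq n).toFinset

@[simp]
theorem mem_ofSize {n : ℕ} {T : BT} : T ∈ ofSize n ↔ T.size = n := by
  simp [ofSize]

theorem ofSize_zero : ofSize 0 = {nil} := by
  ext (_ | ⟨l, r⟩) <;> simp [size]

theorem sum_ofSize_succ {M : Type*} [AddCommMonoid M] (f : BT → M) (n : ℕ) :
    ∑ T ∈ ofSize (n + 1), f T =
      ∑ p ∈ antidiagonal n, ∑ q ∈ ofSize p.1 ×ˢ ofSize p.2, f (node q.1 q.2) := by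
  rw [Finset.sum_sigma']
  symm
  refine Finset.sum_bij (fun x _ => node x.2.1 x.2.2) ?_ ?_ ?_ ?_
  · rintro ⟨⟨i, j⟩, l, r⟩ h
    simp only [mem_sigma, HasAntidiagonal.mem_antidiagonal, mem_product, mem_ofSize, size] at h ⊢
    omega
  · rintro ⟨⟨i, j⟩, l, r⟩ h ⟨⟨i', j'⟩, l', r'⟩ h' he
    simp only [mem_sigma, HasAntidiagonal.mem_antidiagonal, mem_product, mem_ofSize] at h h'
    obtain ⟨-, rfl, rfl⟩ := h
    obtain ⟨-, rfl, rfl⟩ := h'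
    obtain ⟨rfl, rfl⟩ := node.inj he
    rfl
  · rintro (_ | ⟨l, r⟩) h
    · simp [size] at h
    · refine ⟨⟨(l.size, r.size), l, r⟩, ?_, rfl⟩
      simpa [size] using h
  · intros
    rfl

theorem sum_hookFacProd_ofSize_succ (n : ℕ) :
    ∑ T ∈ ofSize (n + 1), hookFacProd T = (1 + ((n + 1 : ℕ) : ℚ)⁻¹) *
      ∑ p ∈ antidiagonal n,
        (∑ T ∈ ofSize p.1, hookFacProd T) * ∑ T ∈ ofSize p.2, hookFacProd T := by
  rw [sum_ofSize_succ, Finset.mul_sum]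
  refine Finset.sum_congr rfl fun p hp => ?_
  rw [Finset.sum_mul_sum, ← Finset.sum_product', Finset.mul_sum]
  refine Finset.sum_congr rfl fun q hq => ?_
  simp only [mem_product, mem_ofSize] at hq
  rw [hookFacProd, hq.1, hq.2, HasAntidiagonal.mem_antidiagonal.1 hp, mul_assoc]

end BT

theorem Polynomial.eq_of_derivative_eq_of_eval_eq {R : Type*} [CommRing R] [IsAddTorsionFree R]
    {p q : R[X]} (a : R) (hd : derivative p = derivative q) (ha : p.eval a = q.eval a) :
    p = q := by
  have h : p - q = C ((p - q).coeff 0) := eq_C_of_natDegree_eq_zero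
    (derivative_eq_zero.1 (by rw [derivative_sub, hd, sub_self]))
  have h0 : (p - q).coeff 0 = 0 := by
    have := congrArg (eval a) h
    simpa [ha, sub_eq_zero, eq_comm] using this
  rw [h0, C_0] at h
  exact sub_eq_zero.1 h

/-- **Abel's binomial identity** at `x = 1`, as an identity of polynomials in `y`. -/
theorem abel_binomial (n : ℕ) :
    ∑ k ∈ range (n + 1),
      C ((n.choose k : ℚ) * (k + 1) ^ (k - 1)) * (X + C ((n - k : ℕ) : ℚ)) ^ (n - k)
      = (X + C ((n : ℚ) + 1)) ^ n := by
  induction n with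
  | zero => simp
  | succ n ih =>
    refine eq_of_derivative_eq_of_eval_eq (-((n : ℚ) + 2)) ?_ ?_
    · have ih' := congrArg (fun p => C ((n : ℚ) + 1) * p.comp (X + C 1)) ih
      simp only [Polynomial.sum_comp, Polynomial.mul_comp, pow_comp, add_comp, X_comp, C_comp] at ih'
      rw [sum_range_succ, derivative_add, derivative_sum]
      simp only [derivative_mul, derivative_C, derivative_X_add_C_pow, Nat.sub_self, pow_zero,
        derivative_one, zero_mul, mul_zero, add_zero, zero_add]
      convert ih' using 1
      · rw [mul_sum]
        refine sum_congr rfl fun k hk => ?_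
        have hk' : k ≤ n := Nat.lt_succ_iff.1 (mem_range.1 hk)
        have e : n + 1 - k = (n - k) + 1 := by omega
        have hc : ((n + 1).choose k : ℚ) * ((n - k : ℕ) + 1) = (n + 1) * n.choose k := by
          have := Nat.choose_mul_succ_eq n k
          rw [e] at this
          exact_mod_cast (by linarith : (n + 1).choose k * (n - k + 1) = (n + 1) * n.choose k)
        rw [e, Nat.add_sub_cancel, ← mul_assoc, ← mul_assoc, ← C_mul]
        congr 1
        · rw [← C_mul]
          congr 1
          push_cast
          linear_combination ((k : ℚ) + 1) ^ (k - 1) * hc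
        · congr 1
          push_cast
          simp only [C_add, C_1]
          ring
      · push_cast
        simp only [C_add, C_1]
        ring
    · have hdiff := fwdDiff_iter_pow_eq_zero_of_lt (R := ℚ) (Nat.lt_succ_self n)
      have h1 := congrFun hdiff 1
      rw [fwdDiff_iter_eq_sum_shift] at h1
      simp only [eval_finsetSum, eval_mul, eval_C, eval_pow, eval_add, eval_X]
      have hz : (-((n : ℚ) + 2) + (((n + 1 : ℕ) : ℚ) + 1)) ^ (n + 1) = 0 := by
        push_cast
        ring_nf
      rw [hz]
      refine Eq.trans (sum_congr rfl fun k hk => ?_) h1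
      have hk' : k ≤ n + 1 := Nat.lt_succ_iff.1 (mem_range.1 hk)
      have hb : -((n : ℚ) + 2) + ((n + 1 - k : ℕ) : ℚ) = -1 * (k + 1) := by
        rw [Nat.cast_sub hk']
        push_cast
        ring
      have hp : ((k : ℚ) + 1) ^ (k - 1) * (k + 1) ^ (n + 1 - k) = (1 + k) ^ n := by
        rcases k with _ | k
        · simp
        · rw [← pow_add, add_comm (1 : ℚ)]
          congr 1
          omega
      rw [hb, mul_pow]
      simp only [zsmul_eq_mul, nsmul_eq_mul, mul_one]
      push_cast
      rw [← hp]
      ring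

/-- The convolution identity for the number of labelled trees on `k + 1` vertices. -/
theorem sum_choose_mul_succ_pow_pred (n : ℕ) :
    ((n : ℚ) + 2) * ∑ p ∈ antidiagonal n,
      (n.choose p.1 : ℚ) * (p.1 + 1) ^ (p.1 - 1) * (p.2 + 1) ^ (p.2 - 1) =
      2 * (n + 2) ^ n := by
  have hpow (k : ℕ) : ((k : ℚ) + 1) * (k + 1) ^ (k - 1) = (k + 1) ^ k := by
    rcases k with _ | k
    · simp
    · simp [pow_succ']
  have h : ∑ p ∈ antidiagonal n, (n.choose p.1 : ℚ) * (p.1 + 1) ^ (p.1 - 1) * (p.2 + 1) ^ p.2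
      = (n + 2) ^ n := by
    have := congrArg (eval 1) (abel_binomial n)
    simp only [eval_finsetSum, eval_mul, eval_C, eval_pow, eval_add, eval_X] at this
    rw [Finset.Nat.sum_antidiagonal_eq_sum_range_succ_mk]
    simp only [Nat.succ_eq_add_one]
    rw [show (n : ℚ) + 2 = 1 + (n + 1) by ring, ← this]
    refine sum_congr rfl fun k _ => ?_
    rw [add_comm (1 : ℚ)]
  have h' : ∑ p ∈ antidiagonal n, (n.choose p.1 : ℚ) * (p.2 + 1) ^ (p.2 - 1) * (p.1 + 1) ^ p.1
      = (n + 2) ^ n := by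
    rw [← h, ← Finset.Nat.sum_antidiagonal_swap]
    refine sum_congr rfl fun p hp => ?_
    rw [Prod.fst_swap, Prod.snd_swap, Nat.choose_symm_of_eq_add (HasAntidiagonal.mem_antidiagonal.1 hp).symm]
  rw [two_mul]
  nth_rewrite 1 [← h]
  rw [← h', ← sum_add_distrib, mul_sum]
  refine sum_congr rfl fun p hp => ?_
  rw [← hpow p.1, ← hpow p.2, ← HasAntidiagonal.mem_antidiagonal.1 hp]
  push_cast
  ring

theorem BT.sum_hookFacProd_ofSize (n : ℕ) :
    ∑ T ∈ ofSize n, hookFacProd T = 2 ^ n * ((n : ℚ) + 1) ^ (n - 1) / n.factorial := by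
  induction n using Nat.strong_induction_on with
  | _ n ih =>
    rcases n with _ | n
    · simp [ofSize_zero, hookFacProd]
    · have key : ∑ p ∈ antidiagonal n,
          (∑ T ∈ ofSize p.1, hookFacProd T) * ∑ T ∈ ofSize p.2, hookFacProd T =
          2 ^ n / n.factorial * ∑ p ∈ antidiagonal n,
            (n.choose p.1 : ℚ) * (p.1 + 1) ^ (p.1 - 1) * (p.2 + 1) ^ (p.2 - 1) := by
        rw [mul_sum]
        refine sum_congr rfl fun p hp => ?_
        obtain rfl := HasAntidiagonal.mem_antidiagonal.1 hp
        rw [ih p.1 (by omega), ih p.2 (by omega), Nat.cast_add_choose]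
        have h1 := Nat.cast_ne_zero (R := ℚ).2 p.1.factorial_ne_zero
        have h2 := Nat.cast_ne_zero (R := ℚ).2 p.2.factorial_ne_zero
        have h3 := Nat.cast_ne_zero (R := ℚ).2 (p.1 + p.2).factorial_ne_zero
        field_simp
        ring
      have h := sum_choose_mul_succ_pow_pred n
      rw [sum_hookFacProd_ofSize_succ, key, Nat.factorial_succ, Nat.add_sub_cancel]
      have h1 := Nat.cast_ne_zero (R := ℚ).2 n.factorial_ne_zero
      have h2 : (n : ℚ) + 1 ≠ 0 := by positivity
      push_cast
      field_simp
      rw [show (n : ℚ) + 1 + 1 = n + 2 by ring]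
      linear_combination 2 ^ n * h

end

/-- **Postnikov's identity**:
`(n+1)^{n-1} = (n!/2ⁿ) ∑_{T ∈ BT_n} ∏_{v ∈ T} (1 + 1/h_v)`, the (finite) sum being
over all binary trees with `n` nodes. -/
theorem postnikov_identity (n : ℕ) (hn : 1 ≤ n) :
    ((n + 1 : ℚ)) ^ (n - 1)
      = (Nat.factorial n : ℚ) / 2 ^ n * ∑ᶠ T ∈ {T : BT | T.size = n}, hookFacProd T := by
  rw [finsum_mem_eq_finite_toFinset_sum _ (BT.finite_setOf_size_eq n)]
  have h := BT.sum_hookFacProd_ofSize n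
  rw [BT.ofSize] at h
  rw [h]
  have h1 := Nat.cast_ne_zero (R := ℚ).2 n.factorial_ne_zero
  field_simp
end

section
/- For every n ≥ 1, the following identity holds in the polynomial ring ℚ[α]: ∑_{T ∈ BT_n} ∏_{v ∈ T} (α + 1/h_v) = (1/(n+1)!) · ∏_{i=0}^{n−1} ((n+1+i)α + n+1−i), where BT_n is the set of binary trees with n nodes, the product over v runs over all nodes of T, and h_v is the hook length of v (Lascoux's identity, proved by Du and Liu). -/
open Polynomial

/-- The product `∏_{v ∈ T} (α + 1/h_v)` over all nodes `v` of the binary tree `T`,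
as a polynomial in `α = X`; `h_v` is the hook length of `v`. -/
noncomputable def hookTermProd : BT → Polynomial ℚ
  | BT.nil => 1
  | BT.node l r =>
      (X + C (((l.size + r.size + 1 : ℕ) : ℚ))⁻¹) * hookTermProd l * hookTermProd r

/-- The Rothe numbers `x/(x + nz) * (x + nz)(x + nz + 1)⋯(x + nz + n - 1) / n!`, without the
division by `x + nz`. -/
def rothe (z x : ℚ) : ℕ → ℚ
  | 0 => 1
  | n + 1 => x / (n + 1).factorial * ∏ i ∈ Finset.range n, (x + (n + 1) * z + i + 1)

theorem rothe_add_one (z x : ℚ) (n : ℕ) :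
    rothe z (x + 1) (n + 1) = rothe z x (n + 1) + rothe z (x + 1 + z) n := by
  cases n with
  | zero => simp [rothe]
  | succ k =>
    have hk : ((k + 1).factorial : ℚ) ≠ 0 := by positivity
    have e₁ : ∏ i ∈ Finset.range k, (x + 1 + ((k + 1 : ℕ) + 1) * z + i + 1)
        = ∏ i ∈ Finset.range k, (x + ((k + 1 : ℕ) + 1) * z + (i + 1 : ℕ) + 1) :=
      Finset.prod_congr rfl fun i _ => by push_cast; ring
    have e₂ : ∏ i ∈ Finset.range k, (x + 1 + z + (k + 1) * z + i + 1)
        = ∏ i ∈ Finset.range k, (x + ((k + 1 : ℕ) + 1) * z + (i + 1 : ℕ) + 1) :=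
      Finset.prod_congr rfl fun i _ => by push_cast; ring
    simp only [rothe]
    rw [Finset.prod_range_succ, Finset.prod_range_succ', e₁, e₂, Nat.factorial_succ (k + 1)]
    generalize ∏ i ∈ Finset.range k, (x + ((k + 1 : ℕ) + 1) * z + (i + 1 : ℕ) + 1) = P
    have hk2 : (k : ℚ) + 1 + 1 ≠ 0 := by positivity
    push_cast
    field_simp
    ring

/-- The Rothe–Hagen convolution identity, in the case of a natural number as first argument. -/
theorem sum_antidiagonal_rothe_mul (m : ℕ) (y : ℚ) (n a : ℕ) :
    ∑ p ∈ Finset.HasAntidiagonal.antidiagonal n, rothe m a p.1 * rothe m y p.2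
      = rothe m (a + y) n := by
  induction n generalizing a with
  | zero => simp [rothe]
  | succ n ihn =>
    induction a with
    | zero =>
      simp [Finset.Nat.antidiagonal_succ, rothe]
    | succ a iha =>
      rw [Finset.Nat.antidiagonal_succ, Finset.sum_cons, Finset.sum_map] at iha ⊢
      have h := ihn (a + 1 + m)
      push_cast at h iha ⊢
      simp only [Function.Embedding.prodMap, Function.Embedding.coeFn_mk, Prod.map,
        Function.Embedding.refl_apply, Nat.succ_eq_add_one, rothe_add_one, add_mul,
        Finset.sum_add_distrib] at iha ⊢
      rw [h, show (a : ℚ) + 1 + y = a + y + 1 by ring, rothe_add_one, ← iha]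
      simp only [rothe]
      rw [show (a : ℚ) + 1 + m + y = a + y + 1 + m by ring]
      ring

theorem mul_rothe_two_mul (m : ℚ) (n : ℕ) :
    ((n + 2) * m + n) / (2 * (n + 1)) * rothe m (m + m) n = rothe m m (n + 1) := by
  have hn : (n : ℚ) + 1 ≠ 0 := by positivity
  cases n with
  | zero => simp [rothe]
  | succ k =>
    have hk : ((k + 1).factorial : ℚ) ≠ 0 := by positivity
    have e : ∏ i ∈ Finset.range k, (m + m + (k + 1) * m + i + 1)
        = ∏ i ∈ Finset.range k, (m + ((k + 1 : ℕ) + 1) * m + i + 1) :=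
      Finset.prod_congr rfl fun i _ => by push_cast; ring
    simp only [rothe]
    rw [Finset.prod_range_succ, e, Nat.factorial_succ (k + 1)]
    generalize ∏ i ∈ Finset.range k, (m + ((k + 1 : ℕ) + 1) * m + i + 1) = P
    push_cast at hn ⊢
    field_simp
    ring

theorem prod_eq_pow_mul_rothe (m d : ℚ) (n : ℕ) :
    ((n + 1).factorial : ℚ)⁻¹ * ∏ i ∈ Finset.range n, (d * ((n + 1) * m + i))
      = d ^ n * rothe m m n := by
  cases n with
  | zero => simp [rothe]
  | succ k =>
    have hk : ((k + 1).factorial : ℚ) ≠ 0 := by positivity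
    have hk2 : (k : ℚ) + 1 + 1 ≠ 0 := by positivity
    have e : ∏ i ∈ Finset.range k, (((k + 1 : ℕ) + 1) * m + (i + 1 : ℕ))
        = ∏ i ∈ Finset.range k, (m + (k + 1) * m + i + 1) :=
      Finset.prod_congr rfl fun i _ => by push_cast; ring
    rw [Finset.prod_mul_distrib, Finset.prod_const, Finset.card_range, Finset.prod_range_succ', e,
      Nat.factorial_succ (k + 1), rothe]
    generalize ∏ i ∈ Finset.range k, (m + (k + 1) * m + i + 1) = P
    push_cast
    field_simp
    ring

theorem BT.finite_size_le (n : ℕ) : {T : BT | T.size ≤ n}.Finite := by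
  induction n with
  | zero =>
    refine (Set.finite_singleton BT.nil).subset ?_
    rintro (_ | ⟨l, r⟩) h
    · rfl
    · simp [BT.size] at h
  | succ n ih =>
    refine ((ih.image2 BT.node ih).insert BT.nil).subset ?_
    rintro (_ | ⟨l, r⟩) h
    · exact Or.inl rfl
    · simp only [BT.size, Set.mem_ofPred_eq] at h
      exact Or.inr ⟨l, show l.size ≤ n by lia, r, show r.size ≤ n by lia, rfl⟩

theorem BT.finite_size_eq (n : ℕ) : {T : BT | T.size = n}.Finite :=
  (BT.finite_size_le n).subset fun _ h => le_of_eq h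

/-- The binary trees with `n` nodes. -/
noncomputable def BT.treesOfSize (n : ℕ) : Finset BT := (BT.finite_size_eq n).toFinset

@[simp]
theorem BT.mem_treesOfSize {n : ℕ} {T : BT} : T ∈ BT.treesOfSize n ↔ T.size = n := by
  simp [BT.treesOfSize]

theorem BT.treesOfSize_zero : BT.treesOfSize 0 = {BT.nil} := by
  ext (_ | _) <;> simp [BT.size]

theorem BT.sum_treesOfSize_succ {M : Type*} [AddCommMonoid M] (n : ℕ) (f : BT → M) :
    ∑ T ∈ BT.treesOfSize (n + 1), f T
      = ∑ p ∈ Finset.HasAntidiagonal.antidiagonal n, ∑ l ∈ BT.treesOfSize p.1, ∑ r ∈ BT.treesOfSize p.2,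
          f (BT.node l r) := by
  simp_rw [← Finset.sum_product', Finset.sum_sigma']
  symm
  refine Finset.sum_nbij (fun s => BT.node s.2.1 s.2.2) ?_ ?_ ?_ fun _ _ => rfl
  · rintro ⟨⟨i, j⟩, l, r⟩ h
    simp_all [BT.size]
  · rintro ⟨⟨i, j⟩, l, r⟩ h ⟨⟨i', j'⟩, l', r'⟩ h' e
    simp only [BT.node.injEq] at e
    obtain ⟨rfl, rfl⟩ := e
    simp at h h'
    obtain ⟨-, rfl, rfl⟩ := h
    obtain ⟨-, rfl, rfl⟩ := h'
    rfl
  · rintro (_ | ⟨l, r⟩) h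
    · simp [BT.size] at h
    · refine ⟨⟨(l.size, r.size), l, r⟩, ?_, rfl⟩
      simpa [BT.size] using h

theorem sum_hookTermProd_succ (n : ℕ) :
    ∑ T ∈ BT.treesOfSize (n + 1), hookTermProd T
      = (X + C ((n + 1 : ℕ) : ℚ)⁻¹) * ∑ p ∈ Finset.HasAntidiagonal.antidiagonal n,
          (∑ l ∈ BT.treesOfSize p.1, hookTermProd l)
            * ∑ r ∈ BT.treesOfSize p.2, hookTermProd r := by
  rw [BT.sum_treesOfSize_succ, Finset.mul_sum]
  refine Finset.sum_congr rfl fun p hp => ?_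
  rw [Finset.sum_mul_sum, Finset.mul_sum]
  refine Finset.sum_congr rfl fun l hl => ?_
  rw [Finset.mul_sum]
  refine Finset.sum_congr rfl fun r hr => ?_
  rw [BT.mem_treesOfSize] at hl hr
  rw [Finset.HasAntidiagonal.mem_antidiagonal] at hp
  rw [hookTermProd, hl, hr, hp, mul_assoc]

/-- At `α = 1 + d`, where `α + 1 = m * d`, the sum over binary trees is a Rothe number. -/
theorem eval_sum_hookTermProd {m : ℕ} {d : ℚ} (h : m * d = d + 2) (n : ℕ) :
    (∑ T ∈ BT.treesOfSize n, hookTermProd T).eval (1 + d) = d ^ n * rothe m m n := by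
  induction n using Nat.strong_induction_on with
  | _ n ih =>
    cases n with
    | zero => simp [BT.treesOfSize_zero, hookTermProd, rothe]
    | succ n =>
      have hsum : ∑ p ∈ Finset.HasAntidiagonal.antidiagonal n,
          (∑ l ∈ BT.treesOfSize p.1, hookTermProd l).eval (1 + d)
            * (∑ r ∈ BT.treesOfSize p.2, hookTermProd r).eval (1 + d)
          = d ^ n * rothe m (m + m) n := by
        rw [← sum_antidiagonal_rothe_mul, Finset.mul_sum]
        refine Finset.sum_congr rfl fun p hp => ?_
        rw [Finset.HasAntidiagonal.mem_antidiagonal] at hp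
        rw [ih p.1 (by lia), ih p.2 (by lia), ← hp, pow_add]
        ring
      have hn : (n : ℚ) + 1 ≠ 0 := by positivity
      have hfac : 1 + d + ((n : ℚ) + 1)⁻¹ = d * (((n + 2) * m + n) / (2 * (n + 1))) := by
        field_simp
        linear_combination (-(n + 2 : ℚ)) * h
      rw [sum_hookTermProd_succ, eval_mul, eval_finsetSum]
      simp only [eval_mul, eval_add, eval_X, eval_C]
      rw [hsum, ← mul_rothe_two_mul]
      push_cast
      rw [hfac]
      ring

/-- **Lascoux's identity** (proved by Du and Liu), in `ℚ[α]`: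
`∑_{T ∈ BT_n} ∏_{v ∈ T} (α + 1/h_v) = (1/(n+1)!) ∏_{i=0}^{n-1} ((n+1+i)α + n+1-i)`,
the (finite) sum being over all binary trees with `n` nodes. -/
theorem lascoux_identity (n : ℕ) (hn : 1 ≤ n) :
    ∑ᶠ T ∈ {T : BT | T.size = n}, hookTermProd T
      = C ((Nat.factorial (n + 1) : ℚ))⁻¹
        * ∏ i ∈ Finset.range n,
            (C (((n + 1 + i : ℕ) : ℚ)) * X + C (((n + 1 - i : ℕ) : ℚ))) := by
  rw [finsum_mem_eq_finite_toFinset_sum _ (BT.finite_size_eq n)]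
  change ∑ T ∈ BT.treesOfSize n, hookTermProd T = _
  refine Polynomial.eq_of_infinite_eval_eq _ _
    ((Set.infinite_range_of_injective (f := fun j : ℕ => 1 + 2 / ((j : ℚ) + 1)) ?_).mono ?_)
  · intro i j hij
    have hi : (i : ℚ) + 1 ≠ 0 := by positivity
    have hj : (j : ℚ) + 1 ≠ 0 := by positivity
    simp only [add_right_inj] at hij
    field_simp at hij
    exact_mod_cast (by linarith : (i : ℚ) = j)
  · rintro _ ⟨j, rfl⟩
    have hj : (j : ℚ) + 1 ≠ 0 := by positivity
    have h : ((j + 2 : ℕ) : ℚ) * (2 / ((j : ℚ) + 1)) = 2 / ((j : ℚ) + 1) + 2 := by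
      push_cast
      field_simp
      ring
    simp only [Set.mem_ofPred_eq]
    rw [eval_sum_hookTermProd h, ← prod_eq_pow_mul_rothe, eval_mul, eval_C, eval_prod]
    congr 1
    refine Finset.prod_congr rfl fun i hi => ?_
    rw [Finset.mem_range] at hi
    rw [Nat.cast_sub (by lia)]
    simp only [eval_add, eval_mul, eval_C, eval_X]
    generalize 2 / ((j : ℚ) + 1) = d at h ⊢
    push_cast at h ⊢
    linear_combination ((n : ℚ) + 1) * h
end
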